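/- arXiv:1612.02778 — 2 statements merged into one kernel-verified Lean document; each statement's English description precedes it below -/
import Mathlib

section
/- Define polynomials Q_h(q,z) by the recurrence Q_0 = 1, Q_1 = 1 - q z, and for h ≥ 2, Q_h(q,z) = (1 - q^{2h-3}(q^{2h} + q^{2h-2} - 1) z)·Q_{h-1}(q,z) - q^{6h-10}(q^{2h-2} - 1) z²·Q_{h-2}(q,z). Then for all h ≥ 0, Q_h(q,z) = ∑_{i=0}^{h} [h,i]_{q²}·q^{(2h-1)i}·(-z)^i. -/
/-- The q-Pochhammer symbol `(a; q)_n = ∏_{j=0}^{n-1} (1 - a q^j)`. -/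
noncomputable def qPoch {K : Type*} [Field K] (q a : K) (n : ℕ) : K :=
  ∏ j ∈ Finset.range n, (1 - a * q ^ j)

/-- The Gaussian (q-binomial) coefficient `[n, m]_q`. -/
noncomputable def qBinom {K : Type*} [Field K] (q : K) (n m : ℕ) : K :=
  qPoch q q n / (qPoch q q m * qPoch q q (n - m))

/-- The denominator convergents `Q_h(q, z)` of the square series J-fraction. -/
noncomputable def Qconv {K : Type*} [Field K] (q z : K) : ℕ → K
  | 0 => 1
  | 1 => 1 - q * z
  | (h + 2) =>
      (1 - q ^ (2 * (h + 2) - 3) * (q ^ (2 * (h + 2)) + q ^ (2 * (h + 2) - 2) - 1) * z) *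
          Qconv q z (h + 1)
        - q ^ (6 * (h + 2) - 10) * (q ^ (2 * (h + 2) - 2) - 1) * z ^ 2 * Qconv q z h

/-- Gaussian coefficients by the Pascal recurrence. -/
def gaussG {K : Type*} [Field K] (p : K) : ℕ → ℕ → K
  | _, 0 => 1
  | 0, _ + 1 => 0
  | n + 1, m + 1 => gaussG p n m + p ^ (m + 1) * gaussG p n (m + 1)

theorem gaussG_zero_right {K : Type*} [Field K] (p : K) (n : ℕ) : gaussG p n 0 = 1 := by
  cases n <;> rfl

theorem gaussG_succ {K : Type*} [Field K] (p : K) (n m : ℕ) :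
    gaussG p (n + 1) (m + 1) = gaussG p n m + p ^ (m + 1) * gaussG p n (m + 1) := rfl

theorem gaussG_gt {K : Type*} [Field K] (p : K) (n : ℕ) :
    ∀ m, n < m → gaussG p n m = 0 := by
  induction n with
  | zero =>
    intro m hm
    obtain ⟨k, rfl⟩ : ∃ k, m = k + 1 := ⟨m - 1, by omega⟩
    rfl
  | succ n ih =>
    intro m hm
    obtain ⟨k, rfl⟩ : ∃ k, m = k + 1 := ⟨m - 1, by omega⟩
    rw [gaussG_succ, ih k (by omega), ih (k + 1) (by omega)]
    ring

theorem gaussG_B {K : Type*} [Field K] (p : K) (n : ℕ) :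
    ∀ m, p ^ m * (p ^ (m + 1) - 1) * gaussG p n (m + 1) = (p ^ n - p ^ m) * gaussG p n m := by
  induction n with
  | zero =>
    intro m
    cases m with
    | zero => simp [gaussG]
    | succ m => simp [gaussG]
  | succ n ih =>
    intro m
    cases m with
    | zero =>
      have h0 := ih 0
      rw [gaussG_succ]
      rw [gaussG_zero_right] at *
      rw [gaussG_zero_right]
      linear_combination p * h0
    | succ m =>
      have h0 := ih m
      have h1 := ih (m + 1)
      rw [gaussG_succ, gaussG_succ]
      linear_combination p ^ (m + 2) * h1 + p * h0

theorem gaussG_A {K : Type*} [Field K] (p : K) (n m : ℕ) :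
    (p ^ (m + 1) - 1) * gaussG p (n + 1) (m + 1) = (p ^ (n + 1) - 1) * gaussG p n m := by
  have h := gaussG_B p n m
  rw [gaussG_succ]
  linear_combination p * h

theorem qPoch_succ' {K : Type*} [Field K] (p : K) (n : ℕ) :
    qPoch p p (n + 1) = qPoch p p n * (1 - p ^ (n + 1)) := by
  unfold qPoch
  rw [Finset.prod_range_succ]
  ring

theorem gaussG_mul {K : Type*} [Field K] (p : K) (m : ℕ) :
    ∀ k, gaussG p (m + k) m * (qPoch p p m * qPoch p p k) = qPoch p p (m + k) := by
  induction m with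
  | zero => intro k; simp [gaussG_zero_right, qPoch]
  | succ m ih =>
    intro k
    have h := ih k
    have hA := gaussG_A p (m + k) m
    have e : m + 1 + k = m + k + 1 := by omega
    rw [e, qPoch_succ', qPoch_succ']
    linear_combination (1 - p ^ (m + k + 1)) * h - qPoch p p m * qPoch p p k * hA

theorem gaussG_rec {K : Type*} [Field K] (p : K) (h i : ℕ) :
    p ^ (2 * i + 2) * gaussG p (h + 2) (i + 2) = p ^ i * gaussG p (h + 1) (i + 2)
      + p ^ i * (p ^ (h + 2) + p ^ (h + 1) - 1) * gaussG p (h + 1) (i + 1)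
      - p ^ h * (p ^ (h + 1) - 1) * gaussG p h i := by
  have hA := gaussG_A p h i
  have hB := gaussG_B p (h + 1) (i + 1)
  rw [gaussG_succ p (h + 1) (i + 1)]
  by_cases hp : p = 0
  · subst hp
    cases i with
    | zero =>
      cases h with
      | zero => simp [gaussG]
      | succ h => simp [gaussG]
    | succ i =>
      cases h with
      | zero => simp [gaussG]
      | succ h => simp
  · apply mul_left_cancel₀ hp
    linear_combination (p ^ (i + 2) + 1) * hB - p * p ^ h * hA

theorem qPoch_ne {K : Type*} [Field K] (p : K) (hp : ∀ k : ℕ, 1 ≤ k → p ^ k ≠ 1) (n : ℕ) :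
    qPoch p p n ≠ 0 := by
  unfold qPoch
  rw [Finset.prod_ne_zero_iff]
  intro j _ h0
  apply hp (j + 1) (by omega)
  linear_combination -h0

theorem qBinom_eq {K : Type*} [Field K] (p : K) (hp : ∀ k : ℕ, 1 ≤ k → p ^ k ≠ 1) (n m : ℕ)
    (hm : m ≤ n) : qBinom p n m = gaussG p n m := by
  obtain ⟨k, rfl⟩ := Nat.exists_eq_add_of_le hm
  unfold qBinom
  rw [Nat.add_sub_cancel_left, div_eq_iff (mul_ne_zero (qPoch_ne p hp _) (qPoch_ne p hp _)),
    gaussG_mul]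

/-- The `h`-th sum with `w` standing for `q ^ (2 h - 1)`. -/
def sumG {K : Type*} [Field K] (p w x : K) (h : ℕ) : K :=
  ∑ i ∈ Finset.range (h + 1), gaussG p h i * w ^ i * x ^ i

theorem sumG_rec {K : Type*} [Field K] (q w x : K) (h : ℕ) (hw : w * q = (q ^ 2) ^ h) :
    sumG (q ^ 2) (w * q ^ 4) x (h + 2) =
      (1 + w * q ^ 2 * ((q ^ 2) ^ (h + 2) + (q ^ 2) ^ (h + 1) - 1) * x)
        * sumG (q ^ 2) (w * q ^ 2) x (h + 1)
      - w ^ 3 * q ^ 5 * ((q ^ 2) ^ (h + 1) - 1) * x ^ 2 * sumG (q ^ 2) w x h := by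
  have e1 : sumG (q ^ 2) (w * q ^ 2) x (h + 1) =
      ∑ i ∈ Finset.range (h + 3), gaussG (q ^ 2) (h + 1) i * (w * q ^ 2) ^ i * x ^ i := by
    rw [Finset.sum_range_succ, gaussG_gt _ _ (h + 2) (by omega)]
    simp [sumG]
  rw [add_mul, one_mul]
  nth_rewrite 1 [e1]
  unfold sumG
  rw [Finset.sum_range_succ', Finset.sum_range_succ', Finset.sum_range_succ' _ (h + 2),
    Finset.sum_range_succ' _ (h + 1)]
  rw [Finset.sum_range_succ' (fun i => gaussG (q ^ 2) (h + 1) i * (w * q ^ 2) ^ i * x ^ i) (h + 1)]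
  have key : ∀ i ∈ Finset.range (h + 1),
      gaussG (q ^ 2) (h + 2) (i + 1 + 1) * (w * q ^ 4) ^ (i + 1 + 1) * x ^ (i + 1 + 1) =
      gaussG (q ^ 2) (h + 1) (i + 1 + 1) * (w * q ^ 2) ^ (i + 1 + 1) * x ^ (i + 1 + 1)
      + w * q ^ 2 * ((q ^ 2) ^ (h + 2) + (q ^ 2) ^ (h + 1) - 1) * x
        * (gaussG (q ^ 2) (h + 1) (i + 1) * (w * q ^ 2) ^ (i + 1) * x ^ (i + 1))
      - w ^ 3 * q ^ 5 * ((q ^ 2) ^ (h + 1) - 1) * x ^ 2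
        * (gaussG (q ^ 2) h i * w ^ i * x ^ i) := by
    intro i _
    have hr := gaussG_rec (q ^ 2) h i
    linear_combination (w ^ (i + 2) * q ^ 4 * x ^ (i + 2)) * hr
      + w ^ (i + 2) * q ^ 4 * x ^ (i + 2) * ((q ^ 2) ^ (h + 1) - 1) * gaussG (q ^ 2) h i * hw
  rw [Finset.sum_congr rfl key, Finset.sum_sub_distrib, Finset.sum_add_distrib,
    ← Finset.mul_sum, ← Finset.mul_sum]
  have h1 := gaussG_B (q ^ 2) (h + 1) 0
  have h2 := gaussG_succ (q ^ 2) (h + 1) 0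
  simp only [gaussG_zero_right, zero_add, pow_zero, pow_one, mul_one, one_mul] at h1 h2 ⊢
  rw [h2]
  linear_combination w * q ^ 2 * x * (q ^ 2 + 1) * h1

theorem Qconv_eq_sumG {K : Type*} [Field K] (q z : K) (hq : q ≠ 0) (h : ℕ) :
    Qconv q z h = sumG (q ^ 2) (q ^ (2 * (h : ℤ) - 1)) (-z) h := by
  induction h using Nat.twoStepInduction with
  | zero => simp [Qconv, sumG, gaussG]
  | one => simp [Qconv, sumG, gaussG, Finset.sum_range_succ]; ring
  | more h ih0 ih1 =>
    have hw : q ^ (2 * (h : ℤ) - 1) * q = (q ^ 2) ^ h := by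
      rw [← zpow_add_one₀ hq, ← pow_mul, ← zpow_natCast]; congr 1; push_cast; ring
    have w1 : q ^ (2 * ((h + 1 : ℕ) : ℤ) - 1) = q ^ (2 * (h : ℤ) - 1) * q ^ 2 := by
      rw [← zpow_natCast q 2, ← zpow_add₀ hq]; congr 1; push_cast; ring
    have w2 : q ^ (2 * ((h + 2 : ℕ) : ℤ) - 1) = q ^ (2 * (h : ℤ) - 1) * q ^ 4 := by
      rw [← zpow_natCast q 4, ← zpow_add₀ hq]; congr 1; push_cast; ring
    rw [w1] at ih1
    rw [w2, sumG_rec q _ _ h hw, ← ih0, ← ih1, Qconv]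
    generalize q ^ (2 * (h : ℤ) - 1) = w at hw
    have a1 : 2 * (h + 2) - 3 = 2 * h + 1 := by omega
    have a2 : 2 * (h + 2) - 2 = 2 * (h + 1) := by omega
    have a3 : 6 * (h + 2) - 10 = 6 * h + 2 := by omega
    have b1 : q ^ (2 * h + 1) = w * q ^ 2 := by
      rw [pow_succ, pow_mul, ← hw]; ring
    have b3 : q ^ (6 * h + 2) = w ^ 3 * q ^ 5 := by
      have : q ^ (6 * h + 2) = ((q ^ 2) ^ h) ^ 3 * q ^ 2 := by ring
      rw [this, ← hw]; ring
    rw [a1, a2, a3, b1, b3, pow_mul q 2 (h + 2), pow_mul q 2 (h + 1)]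
    ring

theorem stmt4 {K : Type*} [Field K] (q z : K) (hq : q ≠ 0)
    (hroot : ∀ k : ℕ, 1 ≤ k → q ^ k ≠ 1) (h : ℕ) :
    Qconv q z h =
      ∑ i ∈ Finset.range (h + 1),
        qBinom (q ^ 2) h i * q ^ ((2 * (h : ℤ) - 1) * (i : ℤ)) * (-z) ^ i := by
  rw [Qconv_eq_sumG q z hq h]
  unfold sumG
  apply Finset.sum_congr rfl
  intro i hi
  rw [qBinom_eq (q ^ 2) _ h i (by simpa [Nat.lt_succ_iff] using hi), zpow_mul, zpow_natCast]
  intro k hk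
  rw [← pow_mul]
  exact hroot _ (by omega)
end

section
/- For all integers n ≥ 0: r₄(2n+1) = 8·σ₁(2n+1), where r₄(m) is the number of representations of m as an ordered sum of four squares of integers and σ₁ is the sum-of-divisors function; equivalently, the generating function identity ∑_{k=0}^{∞} σ₁(2k+1) q^{2k+1} = (ϑ₃(q)⁴ - ϑ₃(-q)⁴)/16 holds for 0 < |q| < 1, where ϑ₃(q) = ∑_{n=-∞}^{∞} q^{n²}. -/
/-- `rSq p m` is the number of representations of `m` as an ordered sum of `p` squares
of integers. -/
noncomputable def rSq (p m : ℕ) : ℕ :=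
  Nat.card {x : Fin p → ℤ // ∑ i, (x i) ^ 2 = (m : ℤ)}

/-- The Jacobi theta function `ϑ₃(q) = ∑_{n ∈ ℤ} q^{n²}`. -/
noncomputable def theta3 (q : ℂ) : ℂ :=
  ∑' n : ℤ, q ^ (n ^ 2)

open Finset

noncomputable def WSet (N : ℤ) : Finset (ℤ × ℤ × ℤ) :=
  ((Icc (-N) N) ×ˢ (Icc 1 N) ×ˢ (Icc 1 N)).filter (fun t => t.1 ^ 2 + 4 * t.2.1 * t.2.2 = N)

lemma mem_WSet {N : ℤ} {j e d : ℤ} :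
    (j, e, d) ∈ WSet N ↔ 0 < e ∧ 0 < d ∧ j ^ 2 + 4 * e * d = N := by
  simp only [WSet, mem_filter, mem_product, mem_Icc]
  constructor
  · rintro ⟨h, h2⟩
    exact ⟨by omega, by omega, h2⟩
  · rintro ⟨h1, h2, h3⟩
    have := mul_pos h1 h2
    refine ⟨⟨⟨?_, ?_⟩, ⟨by omega, ?_⟩, ⟨by omega, ?_⟩⟩, h3⟩ <;> nlinarith [sq_nonneg j, sq_nonneg (j-1), sq_nonneg (j+1)]

def psi (t : ℤ × ℤ × ℤ) : ℤ := (t.2.1 + t.2.2) * (t.2.1 - t.1) * (t.2.2 + t.1)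

lemma sum_W_flip (N : ℤ) (f : ℤ × ℤ × ℤ → ℤ) :
    ∑ t ∈ WSet N, f t = ∑ t ∈ WSet N, f (-t.1, t.2) := by
  refine sum_nbij' (fun t => (-t.1, t.2)) (fun t => (-t.1, t.2)) ?_ ?_ ?_ ?_ ?_
  all_goals (rintro ⟨j, e, d⟩; simp [mem_WSet])

lemma sum_W_swap (N : ℤ) (f : ℤ × ℤ × ℤ → ℤ) :
    ∑ t ∈ WSet N, f t = ∑ t ∈ WSet N, f (t.1, t.2.2, t.2.1) := by
  refine sum_nbij' (fun t => (t.1, t.2.2, t.2.1)) (fun t => (t.1, t.2.2, t.2.1)) ?_ ?_ ?_ ?_ ?_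
  all_goals (rintro ⟨j, e, d⟩; simp [mem_WSet])
  all_goals (intro h1 h2 h3; refine ⟨h2, h1, by linarith⟩)

lemma sum_psi (N : ℤ) : ∑ t ∈ WSet N, psi t
    = 2 * ∑ t ∈ WSet N, t.2.1 * (t.2.1 * t.2.2 - t.1 ^ 2) := by
  have h1 : 2 * ∑ t ∈ WSet N, psi t = 2 * ∑ t ∈ WSet N, (t.2.1 + t.2.2) * (t.2.1 * t.2.2 - t.1 ^ 2) := by
    rw [two_mul]
    nth_rewrite 2 [sum_W_flip]
    rw [← sum_add_distrib, mul_sum]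
    refine sum_congr rfl fun t _ => ?_
    simp only [psi]; ring
  have h2 := sum_W_swap N (fun t => t.2.1 * (t.2.1 * t.2.2 - t.1 ^ 2))
  have h3 : ∑ t ∈ WSet N, (t.2.1 + t.2.2) * (t.2.1 * t.2.2 - t.1 ^ 2) =
     ∑ t ∈ WSet N, t.2.1 * (t.2.1 * t.2.2 - t.1 ^ 2) + ∑ t ∈ WSet N, t.2.2 * (t.2.2 * t.2.1 - t.1 ^ 2) := by
    rw [← sum_add_distrib]
    refine sum_congr rfl fun t _ => ?_
    ring
  simp only at h2
  linarith

lemma sum_psi_A (N : ℤ) : ∑ t ∈ (WSet N).filter (fun t => 0 < t.2.2 + t.1 - t.2.1), psi t = 0 := by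
  refine sum_involution (fun t _ => (2 * t.2.1 - t.1, t.2.1, t.2.2 + t.1 - t.2.1)) ?_ ?_ ?_ ?_
  · rintro ⟨j, e, d⟩ _; simp only [psi]; ring
  · rintro ⟨j, e, d⟩ _ h h'
    simp only [Prod.mk.injEq] at h'
    apply h
    have : e = j := by omega
    simp [psi, this]
  · rintro ⟨j, e, d⟩ h
    simp only [mem_filter, mem_WSet] at h ⊢
    refine ⟨⟨h.1.1, h.2, ?_⟩, ?_⟩
    · rw [← h.1.2.2]; ring
    · linarith [h.1.2.1]
  · rintro ⟨j, e, d⟩ h; simp only [Prod.mk.injEq]; refine ⟨by ring, trivial, by ring⟩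

lemma sum_psi_B (N : ℤ) : ∑ t ∈ (WSet N).filter (fun t => t.2.2 + t.1 - t.2.1 < 0), psi t = 0 := by
  refine sum_involution (fun t _ => (-2 * t.2.2 - t.1, t.2.1 - t.1 - t.2.2, t.2.2)) ?_ ?_ ?_ ?_
  · rintro ⟨j, e, d⟩ _; simp only [psi]; ring
  · rintro ⟨j, e, d⟩ _ h h'
    simp only [Prod.mk.injEq] at h'
    apply h
    have : d = -j := by omega
    simp [psi, this]
  · rintro ⟨j, e, d⟩ h
    simp only [mem_filter, mem_WSet] at h ⊢
    refine ⟨⟨by linarith [h.2], h.1.2.1, ?_⟩, ?_⟩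
    · rw [← h.1.2.2]; ring
    · linarith [h.1.1]
  · rintro ⟨j, e, d⟩ h; simp only [Prod.mk.injEq]; refine ⟨by ring, by ring, trivial⟩

lemma sum_psi_C (N : ℤ) : ∑ t ∈ WSet N, psi t =
    ∑ t ∈ (WSet N).filter (fun t => t.2.2 + t.1 - t.2.1 = 0), psi t := by
  rw [← sum_filter_add_sum_filter_not (WSet N) (fun t => 0 < t.2.2 + t.1 - t.2.1), sum_psi_A, zero_add,
    ← sum_filter_add_sum_filter_not _ (fun t => t.2.2 + t.1 - t.2.1 < 0)]
  have h1 := sum_psi_B N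
  have e1 : ((WSet N).filter (fun t => ¬ 0 < t.2.2 + t.1 - t.2.1)).filter (fun t => t.2.2 + t.1 - t.2.1 < 0)
    = (WSet N).filter (fun t => t.2.2 + t.1 - t.2.1 < 0) := by
    ext t; simp only [mem_filter]
    constructor
    · tauto
    · rintro ⟨a, b⟩; exact ⟨⟨a, by omega⟩, b⟩
  have e2 : ((WSet N).filter (fun t => ¬ 0 < t.2.2 + t.1 - t.2.1)).filter (fun t => ¬ t.2.2 + t.1 - t.2.1 < 0)
    = (WSet N).filter (fun t => t.2.2 + t.1 - t.2.1 = 0) := by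
    ext t; simp only [mem_filter]
    constructor
    · rintro ⟨⟨a, b⟩, c⟩; exact ⟨a, by omega⟩
    · rintro ⟨a, b⟩; exact ⟨⟨a, by omega⟩, by omega⟩
  rw [e1, e2, h1, zero_add]

lemma sum_range_aux (n : ℕ) (s : ℤ) : 6 * ∑ k ∈ range n, ((k : ℤ) + 1) * (s - (k + 1)) =
    n * (n + 1) * (3 * s - 2 * n - 1) := by
  induction n with
  | zero => simp
  | succ n ih => rw [sum_range_succ, mul_add, ih]; push_cast; ring

noncomputable def RR (N : ℤ) : ℤ := ∑ t ∈ WSet N, t.2.1 * (t.2.1 * t.2.2 - t.1 ^ 2)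

lemma RR_sq (s : ℕ) : 12 * RR ((s : ℤ) ^ 2) = (s : ℤ) ^ 2 * ((s : ℤ) ^ 2 - 1) := by
  rcases s with _ | n
  · have : WSet 0 = ∅ := by
      ext ⟨j, e, d⟩
      simp only [mem_WSet, notMem_empty, iff_false]
      rintro ⟨h1, h2, h3⟩
      nlinarith [mul_pos h1 h2, sq_nonneg j]
    simp [RR, this]
  have h := sum_psi ((n + 1 : ℕ) ^ 2 : ℤ)
  rw [sum_psi_C] at h
  have h2 : ∑ t ∈ (WSet ((n + 1 : ℕ) ^ 2 : ℤ)).filter (fun t => t.2.2 + t.1 - t.2.1 = 0), psi t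
     = ∑ k ∈ range n, ((n : ℤ) + 1) * (((k : ℤ) + 1) * ((n + 1 : ℤ) - (k + 1))) := by
    refine sum_nbij' (fun t => (t.2.1 - 1).toNat)
      (fun k => (2 * ((k : ℤ) + 1) - (n + 1), (k : ℤ) + 1, (n : ℤ) - k)) ?_ ?_ ?_ ?_ ?_
    · rintro ⟨j, e, d⟩ h
      simp only [mem_filter, mem_WSet] at h
      obtain ⟨⟨h1, h2, h3⟩, h4⟩ := h
      have hs : e + d = n + 1 := by
        have : (e + d) ^ 2 = ((n + 1 : ℕ) : ℤ) ^ 2 := by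
          rw [← h3]; have : j = e - d := by omega
          subst this; ring
        have := (pow_left_inj₀ (by omega) (by omega) two_ne_zero).1 this
        simpa using this
      simp only [mem_range]; omega
    · intro k hk
      simp only [mem_range] at hk
      simp only [mem_filter, mem_WSet]
      refine ⟨⟨by omega, by omega, ?_⟩, by ring⟩
      push_cast; ring
    · rintro ⟨j, e, d⟩ h
      simp only [mem_filter, mem_WSet] at h
      obtain ⟨⟨h1, h2, h3⟩, h4⟩ := h
      have hs : e + d = n + 1 := by
        have : (e + d) ^ 2 = ((n + 1 : ℕ) : ℤ) ^ 2 := by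
          rw [← h3]; have : j = e - d := by omega
          subst this; ring
        have := (pow_left_inj₀ (by omega) (by omega) two_ne_zero).1 this
        simpa using this
      simp only [Prod.mk.injEq]
      omega
    · intro k hk
      simp
    · rintro ⟨j, e, d⟩ h
      simp only [mem_filter, mem_WSet] at h
      obtain ⟨⟨h1, h2, h3⟩, h4⟩ := h
      have hs : e + d = n + 1 := by
        have : (e + d) ^ 2 = ((n + 1 : ℕ) : ℤ) ^ 2 := by
          rw [← h3]; have : j = e - d := by omega
          subst this; ring
        have := (pow_left_inj₀ (by omega) (by omega) two_ne_zero).1 this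
        simpa using this
      have h5 : (((e - 1).toNat : ℕ) : ℤ) = e - 1 := Int.toNat_of_nonneg (by omega)
      simp only [psi, h5, ← hs]
      have : j = e - d := by omega
      subst this; ring
  rw [h2, ← mul_sum] at h
  have h3 := sum_range_aux n (n + 1)
  have : 12 * RR ((n + 1 : ℕ) ^ 2 : ℤ) = 6 * (2 * RR ((n + 1 : ℕ) ^ 2 : ℤ)) := by ring
  rw [this, RR, ← h]
  push_cast
  linear_combination (n + 1 : ℤ) * h3

lemma RR_nsq (N : ℤ) (hN : ¬ IsSquare N) : RR N = 0 := by
  have h := sum_psi N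
  rw [sum_psi_C] at h
  rw [filter_false_of_mem, sum_empty] at h
  · unfold RR; omega
  · rintro ⟨j, e, d⟩ h h'
    simp only [mem_WSet] at h h'
    apply hN
    refine ⟨e + d, ?_⟩
    rw [← h.2.2]
    have : j = e - d := by omega
    subst this; ring

lemma RR_key (n : ℤ) : RR (4 * n) - 16 * RR n = if IsSquare n then n else 0 := by
  split_ifs with h
  · obtain ⟨r, rfl⟩ := h
    have h1 := RR_sq r.natAbs
    have h2 := RR_sq (2 * r.natAbs)
    have e1 : ((2 * r.natAbs : ℕ) : ℤ) ^ 2 = 4 * (r * r) := by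
      push_cast; rw [mul_pow, sq_abs]; ring
    have e2 : ((r.natAbs : ℕ) : ℤ) ^ 2 = r * r := by
      push_cast; rw [sq_abs]; ring
    rw [e1] at h2; rw [e2] at h1
    linarith
  · rw [RR_nsq n h, RR_nsq]; · rfl
    rintro ⟨r, hr⟩
    apply h
    have : (2 : ℤ) ∣ r := by
      have : (2 : ℤ) ∣ r * r := ⟨2 * n, by rw [← hr]; ring⟩
      rcases Int.prime_two.dvd_or_dvd this with h | h <;> exact h
    obtain ⟨k, rfl⟩ := this
    exact ⟨k, by linarith⟩

lemma rec_unique (F G : ℤ → ℤ) (hF0 : F 0 = G 0) (hF : ∀ m < 0, F m = 0) (hG : ∀ m < 0, G m = 0)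
    (rF : ∀ n > 0, ∑ x ∈ Icc (-n) n, (n - 5 * x ^ 2) * F (n - x ^ 2) = 0)
    (rG : ∀ n > 0, ∑ x ∈ Icc (-n) n, (n - 5 * x ^ 2) * G (n - x ^ 2) = 0) (n : ℕ) :
    F n = G n := by
  induction n using Nat.strong_induction_on with
  | _ n ih =>
  rcases Nat.eq_zero_or_pos n with rfl | hn
  · simpa using hF0
  have hn' : (0 : ℤ) < n := by exact_mod_cast hn
  have h1 := rF n hn'
  have h2 := rG n hn'
  have h0 : (0 : ℤ) ∈ Icc (-(n : ℤ)) n := by simp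
  rw [← add_sum_erase _ _ h0] at h1 h2
  have h3 : ∑ x ∈ (Icc (-(n : ℤ)) n).erase 0, (n - 5 * x ^ 2) * F (n - x ^ 2) =
      ∑ x ∈ (Icc (-(n : ℤ)) n).erase 0, (n - 5 * x ^ 2) * G (n - x ^ 2) := by
    refine sum_congr rfl fun x hx => ?_
    have hx0 : x ≠ 0 := (mem_erase.1 hx).1
    have hx2 : 0 < x ^ 2 := by positivity
    congr 1
    rcases lt_or_ge ((n : ℤ) - x ^ 2) 0 with h | h
    · rw [hF _ h, hG _ h]
    · have := ih ((n : ℤ) - x ^ 2).toNat (by omega)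
      rwa [Int.toNat_of_nonneg h] at this
  have h4 : (n : ℤ) * F n = n * G n := by
    simp only [ne_eq, OfNat.ofNat_ne_zero, not_false_eq_true, zero_pow, mul_zero, sub_zero] at h1 h2
    linarith
  exact mul_left_cancel₀ hn'.ne' h4

noncomputable def DD (k m : ℤ) : ℤ :=
  ∑ t ∈ (Icc 1 m ×ˢ Icc 1 m).filter (fun t => k * t.1 * t.2 = m), t.1

lemma rec_DD4 (n : ℤ) (hn : 0 < n) :
    ∑ x ∈ Icc (-n) n, (n - 5 * x ^ 2) * DD 4 (n - x ^ 2) = 4 * RR n := by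
  simp only [DD, mul_sum, RR]
  rw [sum_sigma']
  refine sum_nbij' (fun t => (t.1, t.2)) (fun t => ⟨t.1, t.2⟩) ?_ ?_ ?_ ?_ ?_
  · rintro ⟨x, e, d⟩ h
    simp only [mem_sigma, mem_filter, mem_product, mem_Icc] at h
    simp only [mem_WSet]
    exact ⟨by omega, by omega, by linarith [h.2.2]⟩
  · rintro ⟨x, e, d⟩ h
    simp only [mem_WSet] at h
    simp only [mem_sigma, mem_filter, mem_product, mem_Icc]
    obtain ⟨h1, h2, h3⟩ := h
    have := mul_pos h1 h2
    refine ⟨⟨?_, ?_⟩, ⟨⟨by omega, ?_⟩, ⟨by omega, ?_⟩⟩, by linarith⟩ <;>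
      nlinarith [sq_nonneg x, sq_nonneg (x-1), sq_nonneg (x+1)]
  · simp
  · simp
  · rintro ⟨x, e, d⟩ h
    simp only [mem_sigma, mem_filter, mem_product, mem_Icc] at h
    have : n = 4 * e * d + x ^ 2 := by linarith [h.2.2]
    subst this
    ring

lemma rec_DD1 (n : ℤ) (hn : 0 < n) :
    ∑ x ∈ Icc (-n) n, (n - 5 * x ^ 2) * DD 1 (n - x ^ 2) = RR (4 * n) := by
  simp only [DD, mul_sum, RR]
  rw [sum_sigma']
  refine sum_nbij' (fun t => (2 * t.1, t.2)) (fun t => ⟨t.1 / 2, t.2⟩) ?_ ?_ ?_ ?_ ?_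
  · rintro ⟨x, e, d⟩ h
    simp only [mem_sigma, mem_filter, mem_product, mem_Icc] at h
    simp only [mem_WSet]
    exact ⟨by omega, by omega, by linarith [h.2.2]⟩
  · rintro ⟨j, e, d⟩ h
    simp only [mem_WSet] at h
    simp only [mem_sigma, mem_filter, mem_product, mem_Icc]
    obtain ⟨h1, h2, h3⟩ := h
    have h2j : (2 : ℤ) ∣ j := by
      have : (2 : ℤ) ∣ j ^ 2 := ⟨2 * (n - e * d), by linarith⟩
      exact Int.prime_two.dvd_of_dvd_pow this
    obtain ⟨x, rfl⟩ := h2j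
    rw [Int.mul_ediv_cancel_left _ two_ne_zero]
    have := mul_pos h1 h2
    refine ⟨⟨?_, ?_⟩, ⟨⟨by omega, ?_⟩, ⟨by omega, ?_⟩⟩, by linarith⟩ <;>
      nlinarith [sq_nonneg x, sq_nonneg (x-1), sq_nonneg (x+1)]
  · simp
  · rintro ⟨j, e, d⟩ h
    simp only [mem_WSet] at h
    obtain ⟨h1, h2, h3⟩ := h
    have h2j : (2 : ℤ) ∣ j := by
      have : (2 : ℤ) ∣ j ^ 2 := ⟨2 * (n - e * d), by linarith⟩
      exact Int.prime_two.dvd_of_dvd_pow this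
    obtain ⟨x, rfl⟩ := h2j
    simp
  · rintro ⟨x, e, d⟩ h
    simp only [mem_sigma, mem_filter, mem_product, mem_Icc] at h
    have : n = 1 * e * d + x ^ 2 := by linarith [h.2.2]
    subst this
    ring

lemma rec_delta (n : ℤ) (hn : 0 < n) :
    ∑ x ∈ Icc (-n) n, (n - 5 * x ^ 2) * (if n - x ^ 2 = 0 then 1 else 0) =
      -8 * if IsSquare n then n else 0 := by
  simp only [mul_ite, mul_one, mul_zero]
  rw [← sum_filter]
  split_ifs with h
  · obtain ⟨r, rfl⟩ := h
    have hr : r ≠ 0 := by rintro rfl; simp at hn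
    have : (Icc (-(r * r)) (r * r)).filter (fun x => r * r - x ^ 2 = 0) = {r, -r} := by
      ext x
      simp only [mem_filter, mem_Icc, mem_insert, mem_singleton]
      constructor
      · rintro ⟨_, h⟩
        have : (x - r) * (x + r) = 0 := by linarith
        rcases mul_eq_zero.1 this with h | h
        · left; omega
        · right; omega
      · have h0 : 0 < r * r := hn
        rintro (rfl | rfl)
        · refine ⟨⟨?_, ?_⟩, by ring⟩ <;> nlinarith [sq_nonneg (x-1), sq_nonneg (x+1)]
        · refine ⟨⟨?_, ?_⟩, by ring⟩ <;> nlinarith [sq_nonneg (r-1), sq_nonneg (r+1)]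
    rw [this, sum_pair (by omega)]
    ring
  · rw [filter_false_of_mem]; · simp
    intro x _ h'
    exact h ⟨x, by linarith⟩

noncomputable def GG (m : ℤ) : ℤ := (if m = 0 then 1 else 0) + 8 * DD 1 m - 32 * DD 4 m

lemma rec_GG (n : ℤ) (hn : n > 0) :
    ∑ x ∈ Icc (-n) n, (n - 5 * x ^ 2) * GG (n - x ^ 2) = 0 := by
  have h1 := rec_delta n hn
  have h2 := rec_DD1 n hn
  have h3 := rec_DD4 n hn
  have h4 := RR_key n
  have : ∑ x ∈ Icc (-n) n, (n - 5 * x ^ 2) * GG (n - x ^ 2) =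
     ∑ x ∈ Icc (-n) n, (n - 5 * x ^ 2) * (if n - x ^ 2 = 0 then 1 else 0)
     + 8 * ∑ x ∈ Icc (-n) n, (n - 5 * x ^ 2) * DD 1 (n - x ^ 2)
     - 32 * ∑ x ∈ Icc (-n) n, (n - 5 * x ^ 2) * DD 4 (n - x ^ 2) := by
    rw [mul_sum, mul_sum, ← sum_add_distrib, ← sum_sub_distrib]
    refine sum_congr rfl fun x _ => ?_
    simp only [GG]; ring
  rw [this, h1, h2, h3]
  linarith

noncomputable def VV (p : ℕ) (m : ℤ) : Finset (Fin p → ℤ) :=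
  (Fintype.piFinset fun _ => Icc (-m) m).filter (fun v => ∑ i, v i ^ 2 = m)

lemma mem_VV {p : ℕ} {m : ℤ} {v : Fin p → ℤ} : v ∈ VV p m ↔ ∑ i, v i ^ 2 = m := by
  simp only [VV, mem_filter, Fintype.mem_piFinset, mem_Icc, and_iff_right_iff_imp]
  intro h i
  have : v i ^ 2 ≤ m := by
    rw [← h]
    exact single_le_sum (f := fun i => v i ^ 2) (fun i _ => sq_nonneg _) (mem_univ i)
  constructor <;> nlinarith [sq_nonneg (v i - 1), sq_nonneg (v i + 1)]

lemma rec_VV (n : ℤ) (hn : n > 0) :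
    ∑ x ∈ Icc (-n) n, (n - 5 * x ^ 2) * ((VV 4 (n - x ^ 2)).card : ℤ) = 0 := by
  have h1 : ∑ x ∈ Icc (-n) n, (n - 5 * x ^ 2) * ((VV 4 (n - x ^ 2)).card : ℤ) =
      ∑ v ∈ VV 5 n, (n - 5 * v 0 ^ 2) := by
    have : ∀ x, (n - 5 * x ^ 2) * ((VV 4 (n - x ^ 2)).card : ℤ) =
        ∑ v ∈ VV 4 (n - x ^ 2), (n - 5 * x ^ 2) := by
      intro x; rw [sum_const, nsmul_eq_mul, mul_comm]
    simp only [this]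
    rw [sum_sigma']
    refine sum_nbij' (fun t => (Fin.cons t.1 t.2 : Fin 5 → ℤ)) (fun v => ⟨v 0, Fin.tail v⟩) ?_ ?_ ?_ ?_ ?_
    · rintro ⟨x, v⟩ h
      simp only [mem_sigma, mem_VV] at h
      rw [mem_VV, Fin.sum_univ_succ]
      simp only [Fin.cons_zero, Fin.cons_succ]
      rw [h.2]; ring
    · intro v h
      have h' := h
      rw [mem_VV, Fin.sum_univ_succ] at h'
      simp only [VV, mem_filter, Fintype.mem_piFinset] at h
      rw [mem_sigma, mem_VV]
      refine ⟨h.1 0, ?_⟩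
      simp only [Fin.tail]
      linarith
    · rintro ⟨x, v⟩ h; simp
    · intro v h; simp
    · rintro ⟨x, v⟩ h; simp
  have h2 : ∀ i : Fin 5, ∑ v ∈ VV 5 n, v i ^ 2 = ∑ v ∈ VV 5 n, v 0 ^ 2 := by
    intro i
    refine sum_nbij' (fun v => v ∘ Equiv.swap 0 i) (fun v => v ∘ Equiv.swap 0 i) ?_ ?_ ?_ ?_ ?_
    · intro v h
      rw [mem_VV] at h ⊢
      rw [← h]
      exact Equiv.sum_comp (Equiv.swap 0 i) (fun j => v j ^ 2)
    · intro v h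
      rw [mem_VV] at h ⊢
      rw [← h]
      exact Equiv.sum_comp (Equiv.swap 0 i) (fun j => v j ^ 2)
    · intro v _; ext j; simp
    · intro v _; ext j; simp
    · intro v _; simp
  have h3 : ∑ v ∈ VV 5 n, n = ∑ i : Fin 5, ∑ v ∈ VV 5 n, v i ^ 2 := by
    rw [sum_comm]
    exact sum_congr rfl fun v hv => (mem_VV.1 hv).symm
  rw [h1, sum_sub_distrib, h3, ← mul_sum]
  simp [h2]

lemma rSq_eq (p m : ℕ) : rSq p m = (VV p m).card := by
  rw [rSq, Nat.subtype_card (VV p m)]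
  intro v; exact mem_VV

lemma four_sq (n : ℕ) : rSq 4 (2 * n + 1) = 8 * ArithmeticFunction.sigma 1 (2 * n + 1) := by
  have h := rec_unique (fun m => ((VV 4 m).card : ℤ)) GG ?_ ?_ ?_ rec_VV rec_GG (2 * n + 1)
  · rw [rSq_eq]
    zify
    push_cast at h ⊢
    rw [h, GG, if_neg (by omega)]
    have h4 : DD 4 (2 * n + 1) = 0 := by
      rw [DD, filter_false_of_mem, sum_empty]
      rintro ⟨e, d⟩ _ h
      simp only [mul_assoc] at h
      omega
    have h1 : DD 1 (2 * n + 1) = ∑ d ∈ (2 * n + 1).divisors, (d : ℤ) := by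
      rw [← Nat.sum_divisorsAntidiagonal (fun d _ => (d : ℤ)), DD]
      refine sum_nbij' (fun t => (t.1.toNat, t.2.toNat)) (fun t => ((t.1 : ℤ), (t.2 : ℤ))) ?_ ?_ ?_ ?_ ?_
      · rintro ⟨e, d⟩ h
        simp only [mem_filter, mem_product, mem_Icc] at h
        rw [Nat.mem_divisorsAntidiagonal]
        refine ⟨?_, by omega⟩
        zify
        rw [Int.toNat_of_nonneg (by omega), Int.toNat_of_nonneg (by omega)]
        linarith
      · rintro ⟨e, d⟩ h
        rw [Nat.mem_divisorsAntidiagonal] at h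
        simp only [mem_filter, mem_product, mem_Icc]
        have h1 := h.1
        simp only at h1
        have he : 0 < e := Nat.pos_of_ne_zero (by rintro rfl; simp at h1)
        have hd : 0 < d := Nat.pos_of_ne_zero (by rintro rfl; simp at h1)
        have := Nat.le_mul_of_pos_left d he
        have := Nat.le_mul_of_pos_right e hd
        refine ⟨⟨⟨by omega, by omega⟩, ⟨by omega, by omega⟩⟩, ?_⟩
        rw [one_mul]; exact_mod_cast h1
      · rintro ⟨e, d⟩ h
        simp only [mem_filter, mem_product, mem_Icc] at h
        simp; omega
      · rintro ⟨e, d⟩ h; simp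
      · rintro ⟨e, d⟩ h
        simp only [mem_filter, mem_product, mem_Icc] at h
        simp; omega
    rw [h4, h1, ArithmeticFunction.sigma_one_apply]
    push_cast; ring
  · have h1 : VV 4 0 = {0} := by
      ext v
      rw [mem_VV, mem_singleton, sum_eq_zero_iff_of_nonneg (fun i _ => sq_nonneg _)]
      constructor
      · intro h; ext i; simpa using h i (mem_univ i)
      · rintro rfl; simp
    simp [h1, GG, DD]
  · intro m hm
    have : VV 4 m = ∅ := by
      ext v
      simp only [mem_VV, notMem_empty, iff_false]
      intro h
      have := sum_nonneg (s := univ) (fun i _ => sq_nonneg (v i))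
      omega
    simp [this]
  · intro m hm
    have : Icc 1 m = ∅ := Icc_eq_empty (by omega)
    simp [GG, DD, this, hm.ne]

lemma summable_theta (q : ℂ) (hq : ‖q‖ < 1) (hq0 : 0 < ‖q‖) : Summable fun n : ℤ => ‖q ^ (n ^ 2)‖ := by
  have hs : Summable fun n : ℕ => ‖q‖ ^ n := summable_geometric_of_lt_one (norm_nonneg _) hq
  have hle : ∀ n : ℕ, ‖q ^ ((n : ℤ) ^ 2)‖ ≤ ‖q‖ ^ n := by
    intro n
    rw [norm_zpow, ← Nat.cast_pow, zpow_natCast]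
    exact pow_le_pow_of_le_one (norm_nonneg _) hq.le (by nlinarith [Nat.zero_le n, Nat.le_self_pow two_ne_zero n])
  have h1 : Summable fun n : ℕ => ‖q ^ ((n : ℤ) ^ 2)‖ := Summable.of_nonneg_of_le (fun _ => norm_nonneg _) hle hs
  refine Summable.of_nat_of_neg h1 ?_
  simpa using h1

def e4 : (ℤ × ℤ) × (ℤ × ℤ) ≃ (Fin 4 → ℤ) where
  toFun t := ![t.1.1, t.1.2, t.2.1, t.2.2]
  invFun v := ((v 0, v 1), (v 2, v 3))
  left_inv t := by simp
  right_inv v := by ext i; fin_cases i <;> rfl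

def nrm (v : Fin 4 → ℤ) : ℕ := (∑ i, v i ^ 2).toNat

lemma nrm_cast (v : Fin 4 → ℤ) : (nrm v : ℤ) = ∑ i, v i ^ 2 :=
  Int.toNat_of_nonneg (sum_nonneg fun i _ => sq_nonneg (v i))

lemma hasSum_quad (f : ℤ → ℂ) (hs : Summable fun n => ‖f n‖) :
    HasSum (fun t : (ℤ × ℤ) × (ℤ × ℤ) => (f t.1.1 * f t.1.2) * (f t.2.1 * f t.2.2))
      ((∑' n, f n) ^ 4) := by
  have hs2n : Summable fun x : ℤ × ℤ => ‖f x.1 * f x.2‖ := Summable.mul_norm hs hs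
  have hs4n := Summable.mul_norm hs2n hs2n
  have e2 := tsum_mul_tsum_of_summable_norm hs hs
  have e4' := tsum_mul_tsum_of_summable_norm hs2n hs2n
  have : (∑' n, f n) ^ 4 = ((∑' n, f n) * (∑' n, f n)) * ((∑' n, f n) * (∑' n, f n)) := by ring
  rw [this, e2, e4']
  exact hs4n.of_norm.hasSum

lemma nrm_e4 (t : (ℤ × ℤ) × (ℤ × ℤ)) :
    (nrm (e4 t) : ℤ) = t.1.1 ^ 2 + t.1.2 ^ 2 + (t.2.1 ^ 2 + t.2.2 ^ 2) := by
  rw [nrm_cast, Fin.sum_univ_four]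
  simp only [e4, Equiv.coe_fn_mk, Matrix.cons_val]
  ring

lemma hasSum_nrm (q : ℂ) (hq : ‖q‖ < 1) (hq0 : 0 < ‖q‖) :
    HasSum (fun v : Fin 4 → ℤ => q ^ nrm v) (theta3 q ^ 4) := by
  have hne : q ≠ 0 := norm_pos_iff.1 hq0
  have hh := hasSum_quad _ (summable_theta q hq hq0)
  rw [← e4.hasSum_iff]
  have : ((fun v : Fin 4 → ℤ => q ^ nrm v) ∘ e4) =
      (fun t : (ℤ × ℤ) × (ℤ × ℤ) => (q ^ (t.1.1 ^ 2) * q ^ (t.1.2 ^ 2)) *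
      (q ^ (t.2.1 ^ 2) * q ^ (t.2.2 ^ 2))) := by
    funext t
    simp only [Function.comp]
    rw [← zpow_natCast, nrm_e4, zpow_add₀ hne, zpow_add₀ hne, zpow_add₀ hne]
  rw [this]
  exact hh

lemma card_fiber (m : ℕ) : rSq 4 m = Nat.card {v // nrm v = m} := by
  rw [rSq]
  refine Nat.card_congr (Equiv.subtypeEquivRight fun v => ?_)
  rw [← nrm_cast]
  exact Nat.cast_inj

lemma finite_fiber (m : ℕ) : Finite {v // nrm v = m} := by
  have h : ({v | nrm v = m} : Set (Fin 4 → ℤ)).Finite := by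
    refine Set.Finite.subset (VV 4 m).finite_toSet ?_
    intro v hv
    rw [Set.mem_ofPred_eq] at hv
    rw [mem_coe, mem_VV, ← nrm_cast, hv]
  exact h.to_subtype

lemma theta_hasSum (q : ℂ) (hq : ‖q‖ < 1) (hq0 : 0 < ‖q‖) :
    HasSum (fun m : ℕ => (rSq 4 m : ℂ) * q ^ m) (theta3 q ^ 4) := by
  have hv := hasSum_nrm q hq hq0
  rw [← (Equiv.sigmaFiberEquiv nrm).hasSum_iff] at hv
  refine hv.sigma ?_
  intro m
  have hfin := finite_fiber m
  have := Fintype.ofFinite {v // nrm v = m}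
  have h1 : (fun c : {v // nrm v = m} =>
      ((fun v : Fin 4 → ℤ => q ^ nrm v) ∘ (Equiv.sigmaFiberEquiv nrm)) ⟨m, c⟩) = fun _ => q ^ m := by
    funext c
    have : (Equiv.sigmaFiberEquiv nrm) ⟨m, c⟩ = c.1 := rfl
    simp only [Function.comp, this, c.2]
  rw [h1, card_fiber, Nat.card_eq_fintype_card, ← nsmul_eq_mul, ← card_univ, ← sum_const]
  exact hasSum_fintype _

theorem stmt18 :
    (∀ n : ℕ, rSq 4 (2 * n + 1) = 8 * ArithmeticFunction.sigma 1 (2 * n + 1))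
      ∧ ∀ q : ℂ, 0 < ‖q‖ → ‖q‖ < 1 →
          ∑' k : ℕ, (ArithmeticFunction.sigma 1 (2 * k + 1) : ℂ) * q ^ (2 * k + 1) =
            (theta3 q ^ 4 - theta3 (-q) ^ 4) / 16 := by
  refine ⟨four_sq, fun q h0 h1 => ?_⟩
  have ha := theta_hasSum q h1 h0
  have hb := theta_hasSum (-q) (by simpa using h1) (by simpa using h0)
  have hc := (ha.sub hb).div_const 16
  have hinj : Function.Injective (fun k : ℕ => 2 * k + 1) := fun a b h => by simpa using h
  rw [← hinj.hasSum_iff] at hc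
  · rw [← hc.tsum_eq]
    refine tsum_congr fun k => ?_
    simp only [Function.comp, four_sq k]
    rw [Odd.neg_pow ⟨k, rfl⟩]
    push_cast; ring
  · intro m hm
    have : Even m := by
      rw [← Nat.not_odd_iff_even]
      rintro ⟨k, rfl⟩
      exact hm ⟨k, rfl⟩
    simp [this.neg_pow]
end
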